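/- Let κ > 0 be the normalizing constant making ρ(x) = κ e^{−1/|x|} χ_{(−1,1)}(x) a probability density, let q be the quantile function of the associated probability measure μ, and let φ(θ) = q(|θ|/π) for θ ∈ (−π,π), extended 2π-periodically. Then the principal-value limit defining the periodic Hilbert transform H{φ}(π/2) does not exist as a finite number: the integrals (1/(2π)) ∫_{η ≤ |t| ≤ π} φ(π/2 − t) cot(t/2) dt diverge as η → 0⁺. -/

import Mathlib

open MeasureTheory Filter Set
open scoped Real

/-- The cumulative distribution function of a measure `μ` on `ℝ`: `F(x) = μ((−∞, x])`. -/
noncomputable def cdfFn (μ : Measure ℝ) (x : ℝ) : ℝ := (μ (Iic x)).toReal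

/-- The quantile function of `μ`: `q(u) = inf {x | F(x) ≥ u}`. -/
noncomputable def quantileFn (μ : Measure ℝ) (u : ℝ) : ℝ := sInf {x : ℝ | u ≤ cdfFn μ x}

/-- The truncated integral whose limit as `η → 0⁺` defines the periodic Hilbert
transform of `f` at `x`: `(1/(2π)) ∫_{η ≤ |t| ≤ π} f(x−t) cot(t/2) dt`. -/
noncomputable def pvH (f : ℝ → ℝ) (x η : ℝ) : ℝ :=
  (1 / (2 * π)) *
    ∫ t in {t : ℝ | η ≤ |t| ∧ |t| ≤ π}, f (x - t) * (Real.cos (t / 2) / Real.sin (t / 2))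

section Quantile

variable {μ : Measure ℝ}

theorem cdfFn_mono [IsFiniteMeasure μ] : Monotone (cdfFn μ) := fun _ _ h =>
  ENNReal.toReal_mono (measure_ne_top _ _) (measure_mono (Iic_subset_Iic.2 h))

theorem mem_lowerBounds_of_cdfFn_lt [IsFiniteMeasure μ] {x u : ℝ} (h : cdfFn μ x < u) :
    x ∈ lowerBounds {y : ℝ | u ≤ cdfFn μ y} := fun _ hy =>
  le_of_not_gt fun hlt => absurd (hy.trans (cdfFn_mono hlt.le)) (not_le.2 h)

theorem le_quantileFn [IsFiniteMeasure μ] {x y u : ℝ} (h : cdfFn μ x < u) (hy : u ≤ cdfFn μ y) :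
    x ≤ quantileFn μ u :=
  le_csInf ⟨y, hy⟩ (mem_lowerBounds_of_cdfFn_lt h)

theorem quantileFn_le [IsFiniteMeasure μ] {x y u : ℝ} (h : cdfFn μ x < u) (hy : u ≤ cdfFn μ y) :
    quantileFn μ u ≤ y :=
  csInf_le ⟨x, mem_lowerBounds_of_cdfFn_lt h⟩ hy

theorem quantileFn_of_nonpos {u : ℝ} (hu : u ≤ 0) : quantileFn μ u = 0 := by
  have : {x : ℝ | u ≤ cdfFn μ x} = univ :=
    eq_univ_of_forall fun x => hu.trans ENNReal.toReal_nonneg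
  rw [quantileFn, this, Real.sInf_univ]

theorem quantileFn_of_one_lt [IsProbabilityMeasure μ] {u : ℝ} (hu : 1 < u) :
    quantileFn μ u = 0 := by
  have : {x : ℝ | u ≤ cdfFn μ x} = ∅ :=
    eq_empty_of_forall_notMem fun x hx => absurd (hu.trans_le hx)
      (not_lt.2 (measureReal_le_one (μ := μ) (s := Iic x)))
  rw [quantileFn, this, Real.sInf_empty]

theorem abs_quantileFn_le [IsProbabilityMeasure μ] {M : ℝ} (hM : 0 ≤ M) (h0 : cdfFn μ (-M) = 0)
    (h1 : cdfFn μ M = 1) (u : ℝ) : |quantileFn μ u| ≤ M := by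
  rcases le_or_gt u 0 with hu | hu
  · simpa [quantileFn_of_nonpos hu]
  rcases le_or_gt u 1 with hu1 | hu1
  · exact abs_le.2 ⟨le_quantileFn (h0.trans_lt hu) (hu1.trans_eq h1.symm),
      quantileFn_le (h0.trans_lt hu) (hu1.trans_eq h1.symm)⟩
  · simpa [quantileFn_of_one_lt hu1]

theorem measurable_quantileFn [IsProbabilityMeasure μ] {M : ℝ} (hM : 0 ≤ M)
    (h0 : cdfFn μ (-M) = 0) (h1 : cdfFn μ M = 1) : Measurable (quantileFn μ) := by
  have hmono : MonotoneOn (quantileFn μ) (Ioc 0 1) := fun u hu v hv huv =>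
    csInf_le_csInf ⟨-M, mem_lowerBounds_of_cdfFn_lt (h0.trans_lt hu.1)⟩
      ⟨M, hv.2.trans_eq h1.symm⟩ fun _ hx => huv.trans hx
  have hb := abs_quantileFn_le hM h0 h1
  obtain ⟨g, hg, hqg⟩ := hmono.exists_monotone_extension
    ⟨-M, by rintro _ ⟨u, -, rfl⟩; exact (abs_le.1 (hb u)).1⟩
    ⟨M, by rintro _ ⟨u, -, rfl⟩; exact (abs_le.1 (hb u)).2⟩
  have : quantileFn μ = (Ioc 0 1).indicator g := by
    ext u
    by_cases hu : u ∈ Ioc (0 : ℝ) 1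
    · rw [indicator_of_mem hu, hqg hu]
    · rw [indicator_of_notMem hu]
      rcases le_or_gt u 0 with h | h
      · exact quantileFn_of_nonpos h
      · exact quantileFn_of_one_lt (lt_of_not_ge fun h' => hu ⟨h, h'⟩)
  rw [this]
  exact hg.measurable.indicator measurableSet_Ioc

end Quantile

section FlatDensity

variable {κ : ℝ} {μ : Measure ℝ}

theorem cdfFn_neg_one_of_flat_density
    (hdens : μ = volume.withDensity (fun x =>
      ENNReal.ofReal (if x ∈ Ioo (-1 : ℝ) 1 then κ * Real.exp (-1 / |x|) else 0))) :
    cdfFn μ (-1) = 0 := by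
  have : μ (Iic (-1)) = 0 := by
    rw [hdens, withDensity_apply _ measurableSet_Iic]
    refine setLIntegral_eq_zero measurableSet_Iic fun x hx => ?_
    simp [not_lt.2 (mem_Iic.1 hx)]
  simp [cdfFn, this]

theorem cdfFn_one_of_flat_density [IsProbabilityMeasure μ]
    (hdens : μ = volume.withDensity (fun x =>
      ENNReal.ofReal (if x ∈ Ioo (-1 : ℝ) 1 then κ * Real.exp (-1 / |x|) else 0))) :
    cdfFn μ 1 = 1 := by
  have : μ (Iic 1)ᶜ = 0 := by
    rw [compl_Iic, hdens, withDensity_apply _ measurableSet_Ioi]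
    refine setLIntegral_eq_zero measurableSet_Ioi fun x hx => ?_
    simp [not_lt.2 (mem_Ioi.1 hx).le]
  rw [cdfFn, (prob_compl_eq_zero_iff measurableSet_Iic).1 this, ENNReal.toReal_one]

theorem cdfFn_zero_of_flat_density [IsProbabilityMeasure μ]
    (hdens : μ = volume.withDensity (fun x =>
      ENNReal.ofReal (if x ∈ Ioo (-1 : ℝ) 1 then κ * Real.exp (-1 / |x|) else 0))) :
    cdfFn μ 0 = 1 / 2 := by
  have hsymm : μ (Iic 0)ᶜ = μ (Iic 0) := by
    rw [compl_Iic, hdens, withDensity_apply _ measurableSet_Ioi,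
      withDensity_apply _ measurableSet_Iic, setLIntegral_congr Iio_ae_eq_Iic.symm,
      ← (Measure.measurePreserving_neg (volume : Measure ℝ)).setLIntegral_comp_preimage_emb
        (MeasurableEquiv.neg ℝ).measurableEmbedding]
    simp only [neg_preimage, neg_Ioi, neg_zero]
    refine setLIntegral_congr_fun measurableSet_Iio fun x _ => ?_
    have : -x ∈ Ioo (-1 : ℝ) 1 ↔ x ∈ Ioo (-1 : ℝ) 1 := by
      simp only [mem_Ioo]; constructor <;> rintro ⟨h, h'⟩ <;> constructor <;> linarith
    simp only [this, abs_neg]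
  have h := probReal_add_probReal_compl (μ := μ) (measurableSet_Iic (a := (0 : ℝ)))
  rw [measureReal_def, measureReal_def, hsymm] at h
  rw [cdfFn]
  linarith

theorem cdfFn_le_of_flat_density [IsProbabilityMeasure μ] (hκ : 0 ≤ κ)
    (hdens : μ = volume.withDensity (fun x =>
      ENNReal.ofReal (if x ∈ Ioo (-1 : ℝ) 1 then κ * Real.exp (-1 / |x|) else 0)))
    {x : ℝ} (hx : 0 ≤ x) : cdfFn μ x ≤ 1 / 2 + κ * Real.exp (-1 / x) * x := by
  have hbd : μ (Ioc 0 x) ≤ ENNReal.ofReal (κ * Real.exp (-1 / x) * x) := by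
    rw [hdens, withDensity_apply _ measurableSet_Ioc]
    calc _ ≤ ∫⁻ _ in Ioc 0 x, ENNReal.ofReal (κ * Real.exp (-1 / x)) := by
          refine setLIntegral_mono measurable_const fun y hy => ENNReal.ofReal_le_ofReal ?_
          split_ifs
          · rw [abs_of_pos hy.1, neg_div, neg_div]
            gcongr
            exacts [hy.1, hy.2]
          · positivity
      _ = _ := by
          rw [setLIntegral_const, Real.volume_Ioc, sub_zero, ← ENNReal.ofReal_mul (by positivity)]
  have hsplit : cdfFn μ x = cdfFn μ 0 + μ.real (Ioc 0 x) := by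
    rw [cdfFn, cdfFn, ← Iic_union_Ioc_eq_Iic hx]
    exact measureReal_union (Iic_disjoint_Ioc le_rfl) measurableSet_Ioc
  rw [hsplit, cdfFn_zero_of_flat_density hdens]
  gcongr
  exact ENNReal.toReal_le_of_le_ofReal (by positivity) hbd

/-- The quantile function of the flat density grows very fast just above `1/2`. -/
theorem le_quantileFn_of_flat_density [IsProbabilityMeasure μ] (hκ : 0 < κ)
    (hdens : μ = volume.withDensity (fun x =>
      ENNReal.ofReal (if x ∈ Ioo (-1 : ℝ) 1 then κ * Real.exp (-1 / |x|) else 0)))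
    {s : ℝ} (hs : 0 < s) (hs' : s ≤ 1 / 2) (hlog : 1 < Real.log (κ / s)) :
    1 / Real.log (κ / s) ≤ quantileFn μ (1 / 2 + s) := by
  have hpos : 0 < Real.log (κ / s) := by linarith
  refine le_quantileFn (y := 1) ?_ (by rw [cdfFn_one_of_flat_density hdens]; linarith)
  refine (cdfFn_le_of_flat_density hκ.le hdens (by positivity)).trans_lt ?_
  have hexp : κ * Real.exp (-1 / (1 / Real.log (κ / s))) = s := by
    rw [div_div_eq_mul_div, div_one, neg_one_mul, Real.exp_neg, Real.exp_log (by positivity)]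
    field_simp
  rw [hexp]
  have : 1 / Real.log (κ / s) < 1 := by rw [div_lt_one hpos]; exact hlog
  nlinarith

end FlatDensity

section PrincipalValue

theorem isCompact_setOf_le_abs_le (a b : ℝ) : IsCompact {t : ℝ | a ≤ |t| ∧ |t| ≤ b} := by
  refine (isCompact_Icc (a := -b) (b := b)).of_isClosed_subset
    ((isClosed_le continuous_const continuous_abs).inter
      (isClosed_le continuous_abs continuous_const)) fun t ht => abs_le.1 ht.2

theorem continuousOn_cot_half {η : ℝ} (hη : 0 < η) :
    ContinuousOn (fun t : ℝ => Real.cos (t / 2) / Real.sin (t / 2))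
      {t : ℝ | η ≤ |t| ∧ |t| ≤ π} := by
  refine ContinuousOn.div (by fun_prop) (by fun_prop) fun t ht => ?_
  have h := abs_le.1 ht.2
  have h0 : t ≠ 0 := abs_pos.1 (hη.trans_le ht.1)
  rw [Ne, Real.sin_eq_zero_iff_of_lt_of_lt] <;> first | linarith [Real.pi_pos] | skip
  simpa using h0

theorem inv_le_cot_half {τ : ℝ} (hτ : 0 < τ) (hτ1 : τ ≤ 1) :
    τ⁻¹ ≤ Real.cos (τ / 2) / Real.sin (τ / 2) := by
  have hsin : 0 < Real.sin (τ / 2) :=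
    Real.sin_pos_of_pos_of_lt_pi (by linarith) (by linarith [Real.pi_gt_three])
  rw [inv_eq_one_div, div_le_div_iff₀ hτ hsin]
  have := Real.sin_le (x := τ / 2) (by linarith)
  have := Real.one_sub_sq_div_two_le_cos (x := τ / 2)
  nlinarith

/-- A bounded measurable function of `|θ|`, extended periodically, times the cotangent kernel is
integrable away from the singularity. -/
theorem integrableOn_mul_cot_half {φ ψ : ℝ → ℝ} {M η : ℝ} (hη : 0 < η)
    (hper : Function.Periodic φ (2 * π)) (hφ : ∀ θ ∈ Ioo (-π) π, φ θ = ψ θ)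
    (hψ : Measurable ψ) (hM : ∀ θ, |ψ θ| ≤ M) :
    IntegrableOn (fun t => φ (π / 2 - t) * (Real.cos (t / 2) / Real.sin (t / 2)))
      {t : ℝ | η ≤ |t| ∧ |t| ≤ π} := by
  have hK := isCompact_setOf_le_abs_le η π
  set G : ℝ → ℝ := fun θ => if θ < π then ψ θ else ψ (θ - 2 * π) with hG
  have hGm : Measurable G :=
    Measurable.ite measurableSet_Iio hψ (hψ.comp (measurable_id.sub_const _))
  have hGb : ∀ θ, ‖G θ‖ ≤ M := fun θ => by
    simp only [hG, Real.norm_eq_abs]; split_ifs <;> exact hM _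
  have hint : IntegrableOn (fun t => G (π / 2 - t) * (Real.cos (t / 2) / Real.sin (t / 2)))
      {t : ℝ | η ≤ |t| ∧ |t| ≤ π} :=
    ((continuousOn_cot_half hη).integrableOn_compact hK).bdd_mul
      (hGm.comp (measurable_id.const_sub _)).aestronglyMeasurable (ae_of_all _ fun t => hGb _)
  refine hint.congr_fun_ae ?_
  have hne : ∀ᵐ t : ℝ ∂volume.restrict {t : ℝ | η ≤ |t| ∧ |t| ≤ π}, t ≠ -(π / 2) :=
    ae_restrict_of_ae (Measure.ae_ne volume _)
  filter_upwards [hne, ae_restrict_mem hK.measurableSet] with t ht htK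
  have htπ := abs_le.1 htK.2
  have hπ := Real.pi_pos
  congr 1
  simp only [hG]
  split_ifs with h
  · exact (hφ _ ⟨by linarith, h⟩).symm
  · rw [← hφ _ ⟨?_, by linarith⟩, hper.sub_eq]
    have : π / 2 - t ≠ π := fun h' => ht (by linarith)
    have := lt_of_le_of_ne (not_lt.1 h) this.symm
    linarith

theorem hasDerivAt_log_log {A t : ℝ} (ht : t ≠ 0) (h : 0 < Real.log A - Real.log t) :
    HasDerivAt (fun t => Real.log (Real.log A - Real.log t))
      (-t⁻¹ / (Real.log A - Real.log t)) t :=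
  ((Real.hasDerivAt_log ht).const_sub _).log h.ne'

theorem tendsto_log_log_atTop (A : ℝ) :
    Tendsto (fun η => Real.log (Real.log A - Real.log η)) (nhdsWithin 0 (Ioi 0)) atTop :=
  Real.tendsto_log_atTop.comp
    (tendsto_atTop_add_const_left _ _ (tendsto_neg_atBot_atTop.comp Real.tendsto_log_nhdsGT_zero))

/-- A function which is nonpositive near `0` and lies below `-1 / (|t| log (A / |t|))` to the left
of `0` has truncated integrals diverging to `-∞`. -/
theorem tendsto_integral_atBot_of_le {g : ℝ → ℝ} {A δ b : ℝ} (hδ : 0 < δ) (hδb : δ ≤ b)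
    (hlog : ∀ t, 0 < t → t ≤ δ → 0 < Real.log A - Real.log t)
    (hint : ∀ η, 0 < η → IntegrableOn g {t : ℝ | η ≤ |t| ∧ |t| ≤ b})
    (hright : ∀ t, 0 < t → t < δ → g t ≤ 0)
    (hleft : ∀ t, 0 < t → t < δ → g (-t) ≤ -(t⁻¹ / (Real.log A - Real.log t))) :
    Tendsto (fun η => ∫ t in {t : ℝ | η ≤ |t| ∧ |t| ≤ b}, g t) (nhdsWithin 0 (Ioi 0)) atBot := by
  have hlim : Tendsto (fun η => (∫ t in {t : ℝ | δ ≤ |t| ∧ |t| ≤ b}, g t) +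
      (Real.log (Real.log A - Real.log δ) + -Real.log (Real.log A - Real.log η)))
      (nhdsWithin 0 (Ioi 0)) atBot :=
    tendsto_atBot_add_const_left _ _ (tendsto_atBot_add_const_left _ _
      (tendsto_neg_atTop_atBot.comp (tendsto_log_log_atTop A)))
  refine tendsto_atBot_mono' _ ?_ hlim
  filter_upwards [Ioo_mem_nhdsGT hδ] with η hη
  set S : ℝ → Set ℝ := fun η => {t : ℝ | η ≤ |t| ∧ |t| ≤ b}
  have hS : ∀ η, MeasurableSet (S η) := fun η => (isCompact_setOf_le_abs_le η b).measurableSet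
  have hsub : S δ ⊆ S η := fun t ht => ⟨hη.2.le.trans ht.1, ht.2⟩
  have hdiff := setIntegral_sdiff (hS δ) (hint η hη.1) hsub
  have hPK : Ioc (-δ) (-η) ⊆ S η \ S δ := fun t ht => by
    have ha : |t| = -t := abs_of_neg (by linarith [ht.2, hη.1])
    simp only [S, Set.mem_sdiff, mem_ofPred_eq, ha, not_and, not_le]
    exact ⟨⟨by linarith [ht.2], by linarith [ht.1]⟩, fun h => by linarith [ht.1]⟩
  have hKint : IntegrableOn g (S η \ S δ) := (hint η hη.1).mono_set sdiff_subset
  have hnonpos : ∀ t ∈ S η \ S δ, g t ≤ 0 := by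
    rintro t ⟨h1, h2⟩
    have h3 : |t| < δ := lt_of_not_ge fun h => h2 ⟨h, h1.2⟩
    have h4 : 0 < |t| := hη.1.trans_le h1.1
    rcases lt_or_gt_of_ne (abs_pos.1 h4) with ht | ht
    · rw [abs_of_neg ht] at h3 h4
      have h5 := hleft (-t) h4 h3
      rw [neg_neg] at h5
      have := hlog (-t) h4 h3.le
      exact h5.trans (neg_nonpos.2 (by positivity))
    · exact hright t ht (by rwa [abs_of_pos ht] at h3)
  have hmono : ∫ t in S η \ S δ, g t ≤ ∫ t in Ioc (-δ) (-η), g t := by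
    have := setIntegral_mono_set (f := fun t => -g t) hKint.neg
      ((ae_restrict_iff' ((hS η).diff (hS δ))).2 (ae_of_all _ fun t ht =>
        neg_nonneg.2 (hnonpos t ht))) (LE.le.eventuallyLE hPK)
    rw [integral_neg, integral_neg] at this
    linarith
  have hle : -δ ≤ -η := by linarith [hη.2]
  have hbd : ∀ t ∈ uIcc (-δ) (-η), t ≠ 0 ∧ 0 < Real.log A - Real.log t := fun t ht => by
    rw [uIcc_of_le hle] at ht
    have := hlog (-t) (by linarith [ht.2, hη.1]) (by linarith [ht.1])
    rw [Real.log_neg_eq_log] at this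
    exact ⟨by linarith [ht.2, hη.1], this⟩
  have hcont : IntervalIntegrable (fun t => -t⁻¹ / (Real.log A - Real.log t)) volume
      (-δ) (-η) := by
    refine ContinuousOn.intervalIntegrable (ContinuousOn.div ?_ ?_ fun t ht => (hbd t ht).2.ne')
    · exact (continuousOn_id.inv₀ fun t ht => (hbd t ht).1).neg
    · exact continuousOn_const.sub (continuousOn_id.log fun t ht => (hbd t ht).1)
  have hFTC := intervalIntegral.integral_eq_sub_of_hasDerivAt
    (fun t ht => hasDerivAt_log_log (hbd t ht).1 (hbd t ht).2) hcont
  rw [intervalIntegral.integral_of_le hle, Real.log_neg_eq_log, Real.log_neg_eq_log] at hFTC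
  have hcmp : ∫ t in Ioc (-δ) (-η), g t ≤
      ∫ t in Ioc (-δ) (-η), -(-t⁻¹ / (Real.log A - Real.log t)) := by
    refine setIntegral_mono_on (hKint.mono_set hPK) hcont.1.neg measurableSet_Ioc fun t ht => ?_
    have := hleft (-t) (by linarith [ht.2, hη.1]) (by linarith [ht.1])
    rwa [neg_neg, Real.log_neg_eq_log, inv_neg] at this
  rw [integral_neg, hFTC] at hcmp
  linarith

end PrincipalValue

/-- For the probability measure with the very flat density `ρ(x) = κ e^{−1/|x|}` on
`(−1,1)`, the principal-value limit defining the periodic Hilbert transform of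
`φ(θ) = q(|θ|/π)` (extended `2π`-periodically) does not exist (as a finite number)
at `θ = π/2`. -/
theorem hilbert_transform_blows_up_for_flat_density
    (κ : ℝ) (hκ : 0 < κ)
    (hnorm : ∫ x in (-1 : ℝ)..1, κ * Real.exp (-1 / |x|) = 1)
    (μ : Measure ℝ) [IsProbabilityMeasure μ]
    (hdens : μ = volume.withDensity (fun x =>
      ENNReal.ofReal (if x ∈ Ioo (-1 : ℝ) 1 then κ * Real.exp (-1 / |x|) else 0)))
    (φ : ℝ → ℝ) (hper : Function.Periodic φ (2 * π))
    (hφ : ∀ θ ∈ Ioo (-π) π, φ θ = quantileFn μ (|θ| / π)) :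
    ¬ ∃ L : ℝ,
      Tendsto (fun η => pvH φ (π / 2) η) (nhdsWithin 0 (Ioi 0)) (nhds L) := by
  rintro ⟨L, hL⟩
  have hπ := Real.pi_gt_three
  have h0 := cdfFn_neg_one_of_flat_density hdens
  have h1 := cdfFn_one_of_flat_density hdens
  have hhalf := cdfFn_zero_of_flat_density hdens
  set δ : ℝ := min 1 (κ * π / Real.exp 2) with hδdef
  have hδ : 0 < δ := lt_min one_pos (by positivity)
  have hδ1 : δ ≤ 1 := min_le_left _ _
  have hlog : ∀ t, 0 < t → t ≤ δ → 2 ≤ Real.log (κ * π) - Real.log t := fun t ht htδ => by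
    have := Real.log_le_log ht (htδ.trans (min_le_right _ _))
    rw [Real.log_div (by positivity) (by positivity), Real.log_exp] at this
    linarith
  have hbot := tendsto_integral_atBot_of_le (b := π) (A := κ * π)
    (g := fun t => φ (π / 2 - t) * (Real.cos (t / 2) / Real.sin (t / 2))) hδ
    (by linarith) (fun t ht htδ => by linarith [hlog t ht htδ])
    (fun η hη => integrableOn_mul_cot_half hη hper hφ
      ((measurable_quantileFn zero_le_one h0 h1).comp (by fun_prop))
      fun θ => abs_quantileFn_le zero_le_one h0 h1 _)
    (fun t ht htδ => ?_) (fun t ht htδ => ?_)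
  · exact not_tendsto_nhds_of_tendsto_atBot
      (hbot.const_mul_atBot (r := 1 / (2 * π)) (by positivity)) L hL
  · have hcot := (inv_pos.2 ht).le.trans (inv_le_cot_half ht (by linarith))
    refine mul_nonpos_of_nonpos_of_nonneg ?_ hcot
    rw [hφ _ ⟨by linarith, by linarith⟩, abs_of_pos (by linarith)]
    refine quantileFn_le (x := -1) (h0.trans_lt (div_pos (by linarith) (by linarith))) ?_
    rw [hhalf, div_le_iff₀ (by linarith)]
    linarith
  · have hcot := inv_le_cot_half ht (by linarith)
    have hl := hlog t ht htδ.le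
    have hκt : Real.log (κ / (t / π)) = Real.log (κ * π) - Real.log t := by
      rw [← Real.log_div (by positivity) ht.ne', div_div_eq_mul_div]
    have hq := le_quantileFn_of_flat_density hκ hdens (s := t / π) (by positivity)
      (by rw [div_le_iff₀ (by linarith)]; linarith) (by rw [hκt]; linarith)
    have harg : (π / 2 + t) / π = 1 / 2 + t / π := by field_simp
    rw [hκt] at hq
    simp only [sub_neg_eq_add, neg_div, Real.cos_neg, Real.sin_neg, div_neg, mul_neg, neg_le_neg_iff]
    rw [hφ _ ⟨by linarith, by linarith⟩, abs_of_pos (by linarith), harg]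
    calc t⁻¹ / (Real.log (κ * π) - Real.log t)
        = 1 / (Real.log (κ * π) - Real.log t) * t⁻¹ := by ring
      _ ≤ _ := mul_le_mul hq hcot (by positivity) (le_trans (by positivity) hq)
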